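/- Let (m, N, a) be a triple as in the context satisfying condition (⋆). Then N ≤ 6, m ≤ 12, and the genus g := ∑_{n=1}^{m−1} d_n satisfies g ≤ 7. -/

import Mathlib

open Finset

/-- The dimension `d_n` of the Hodge eigenspace: `d_n = (1/m)·∑_i ((n·a_i) mod m) − 1`,
where `(x mod m)` is the representative of `x` in `{0, …, m−1}` (here `Int.emod`,
which lands in `{0, …, m−1}` since `m > 0`). -/
def hodgeDim (m N : ℕ) (a : Fin N → ℤ) (n : ℤ) : ℚ :=
  ((∑ i, (n * a i) % (m : ℤ) :) : ℚ) / m - 1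

/-- The hypotheses on a triple `(m, N, a)`: `m ≥ 2`, `N ≥ 4`, `1 ≤ a_i ≤ m − 1` for all `i`,
`gcd(m, a_1, …, a_N) = 1`, and `a_1 + ⋯ + a_N ≡ 0 (mod m)`. -/
def IsTriple (m N : ℕ) (a : Fin N → ℤ) : Prop :=
  2 ≤ m ∧ 4 ≤ N ∧ (∀ i, 1 ≤ a i ∧ a i ≤ (m : ℤ) - 1) ∧
    Int.gcd (m : ℤ) (Finset.univ.gcd a) = 1 ∧ ((m : ℤ) ∣ ∑ i, a i)

/-- Condition (⋆): `N − 3 = ∑_{n=1}^{⌊(m−1)/2⌋} d_n·d_{m−n} + ε`, where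
`ε = d_{m/2}(d_{m/2}+1)/2` if `m` is even and `ε = 0` if `m` is odd. -/
def CondStar (m N : ℕ) (a : Fin N → ℤ) : Prop :=
  (N : ℚ) - 3 =
    (∑ n ∈ Finset.Icc 1 ((m - 1) / 2), hodgeDim m N a n * hodgeDim m N a ((m : ℤ) - n)) +
      if m % 2 = 0 then hodgeDim m N a (m / 2) * (hodgeDim m N a (m / 2) + 1) / 2 else 0

/-- Two `N`-tuples are equivalent (for the modulus `m`) if there is `t` with `gcd(t, m) = 1`
and a permutation `σ` with `a'_i ≡ t·a_{σ(i)} (mod m)` for all `i`. -/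
def EquivTuple (m N : ℕ) (a a' : Fin N → ℤ) : Prop :=
  ∃ t : ℤ, Int.gcd t m = 1 ∧ ∃ σ : Equiv.Perm (Fin N),
    ∀ i, a' i ≡ t * a (σ i) [ZMOD (m : ℤ)]

/-- The twenty triples, each given as the pair of `m` and the tuple `a`
(the number of branch points `N` being the length of the tuple). -/
def twentyTriples : List (ℕ × List ℕ) :=
  [(2, [1,1,1,1]), (2, [1,1,1,1,1,1]), (3, [1,1,2,2]), (4, [1,2,2,3]),
   (6, [2,3,3,4]), (3, [1,1,1,1,2]), (4, [1,1,1,1]), (4, [1,1,2,2,2]),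
   (6, [1,3,4,4]), (3, [1,1,1,1,1,1]), (5, [1,3,3,3]), (6, [1,1,1,3]),
   (6, [1,1,2,2]), (6, [2,2,2,3,3]), (8, [2,4,5,5]), (5, [2,2,2,2,2]),
   (7, [2,4,4,4]), (10, [3,5,6,6]), (9, [3,5,5,5]), (12, [4,6,7,7])]

/-- The dimension of the `x`-eigenspace, for a tuple of residues `α`. -/
def eigenDim {m N : ℕ} (α : Fin N → ZMod m) (x : ZMod m) : ℤ :=
  (∑ i, ((x * α i).val : ℤ)) / m - 1

/-- The total of the eigenspace dimensions. -/
def totalDim {m N : ℕ} [NeZero m] (α : Fin N → ZMod m) : ℤ :=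
  ∑ x ∈ univ.erase (0 : ZMod m), eigenDim α x

/-- Condition (⋆) for a tuple of residues, symmetrised over all nonzero characters. -/
structure StarTuple {m N : ℕ} [NeZero m] (α : Fin N → ZMod m) : Prop where
  four_le : 4 ≤ N
  ne_zero : ∀ i, α i ≠ 0
  sum_eq_zero : ∑ i, α i = 0
  faithful : ∀ x : ZMod m, x ≠ 0 → ∃ i, x * α i ≠ 0
  star : ∑ x ∈ univ.erase (0 : ZMod m), eigenDim α x * eigenDim α (-x) +
      ∑ x ∈ univ.erase (0 : ZMod m) with x = -x, eigenDim α x = 2 * ((N : ℤ) - 3)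

namespace StarTuple

variable {m N : ℕ} [NeZero m] {α : Fin N → ZMod m}

theorem mul_eigenDim_add_one (h : StarTuple α) (x : ZMod m) :
    (m : ℤ) * (eigenDim α x + 1) = ∑ i, ((x * α i).val : ℤ) := by
  have hd : (m : ℤ) ∣ ∑ i, ((x * α i).val : ℤ) := by
    rw [← ZMod.intCast_zmod_eq_zero_iff_dvd]
    push_cast
    simp [← Finset.mul_sum, h.sum_eq_zero]
  rw [eigenDim, sub_add_cancel, Int.mul_ediv_cancel' hd]

theorem eigenDim_nonneg (h : StarTuple α) {x : ZMod m} (hx : x ≠ 0) : 0 ≤ eigenDim α x := by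
  have h1 := h.mul_eigenDim_add_one x
  obtain ⟨i, hi⟩ := h.faithful x hx
  have h2 : (0 : ℤ) < ∑ i, ((x * α i).val : ℤ) := by
    refine Finset.sum_pos' (fun _ _ => by positivity) ⟨i, mem_univ _, ?_⟩
    have := (ZMod.val_ne_zero (x * α i)).2 hi
    omega
  have h3 : (0 : ℤ) < m := by exact_mod_cast NeZero.pos m
  rw [← h1] at h2
  have := pos_of_mul_pos_right h2 h3.le
  omega

theorem eigenDim_add_neg (h : StarTuple α) (x : ZMod m) :
    eigenDim α x + eigenDim α (-x) = (N : ℤ) - 2 - #{i | x * α i = 0} := by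
  have h1 := h.mul_eigenDim_add_one x
  have h2 := h.mul_eigenDim_add_one (-x)
  have h3 : (0 : ℤ) < m := by exact_mod_cast NeZero.pos m
  have h4 : ∑ i, ((x * α i).val : ℤ) + ∑ i, ((-x * α i).val : ℤ) =
      m * ((N : ℤ) - #{i | x * α i = 0}) := by
    have hc : ((N : ℤ) - #{i | x * α i = 0}) = ∑ i, (1 - if x * α i = 0 then 1 else 0 : ℤ) := by
      simp [Finset.sum_sub_distrib]
    rw [hc, ← Finset.sum_add_distrib, Finset.mul_sum]
    refine Finset.sum_congr rfl fun i _ => ?_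
    rw [neg_mul, ZMod.neg_val]
    have := (x * α i).val_lt
    split_ifs with h0
    · simp [h0]
    · push_cast [this.le]; ring
  rw [← h1, ← h2] at h4
  have : (m : ℤ) * (eigenDim α x + eigenDim α (-x) + 2) = m * ((N : ℤ) - #{i | x * α i = 0}) := by
    linarith
  have := mul_left_cancel₀ h3.ne' this
  linarith

omit [NeZero m] in
theorem eigenDim_mul (u x : ZMod m) : eigenDim (fun i => u * α i) x = eigenDim α (u * x) := by
  simp only [eigenDim]
  congr 2
  exact Finset.sum_congr rfl fun i _ => by ring_nf

theorem sum_erase_unit_mul (u : (ZMod m)ˣ) (f : ZMod m → ℤ) :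
    ∑ x ∈ univ.erase (0 : ZMod m), f (u * x) = ∑ x ∈ univ.erase (0 : ZMod m), f x := by
  refine Finset.sum_equiv (Units.mulLeft u) (fun x => ?_) (fun x _ => rfl)
  simp

theorem totalDim_unit_mul (u : (ZMod m)ˣ) :
    totalDim (fun i => (u : ZMod m) * α i) = totalDim α := by
  simp only [totalDim, eigenDim_mul]
  exact sum_erase_unit_mul u _

theorem unit_mul (h : StarTuple α) (u : (ZMod m)ˣ) :
    StarTuple fun i => (u : ZMod m) * α i where
  four_le := h.four_le
  ne_zero i := by simpa using h.ne_zero i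
  sum_eq_zero := by rw [← Finset.mul_sum, h.sum_eq_zero, mul_zero]
  faithful x hx := by
    obtain ⟨i, hi⟩ := h.faithful x hx
    exact ⟨i, by rwa [mul_left_comm, Ne, Units.mul_right_eq_zero]⟩
  star := by
    rw [← h.star, Finset.sum_filter, Finset.sum_filter]
    simp only [eigenDim_mul]
    congr 1
    · simp only [mul_neg]
      exact sum_erase_unit_mul u fun x => eigenDim α x * eigenDim α (-x)
    · refine Eq.trans ?_ (sum_erase_unit_mul u fun x => if x = -x then eigenDim α x else 0)
      refine Finset.sum_congr rfl fun x _ => ?_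
      have : (u : ZMod m) * x = -(u * x) ↔ x = -x := by
        rw [← mul_neg, Units.mul_right_inj]
      simp only [this]

theorem mul_neg_nonneg (h : StarTuple α) {x : ZMod m} (hx : x ≠ 0) :
    0 ≤ eigenDim α x * eigenDim α (-x) :=
  mul_nonneg (h.eigenDim_nonneg hx) (h.eigenDim_nonneg (neg_ne_zero.2 hx))

theorem sum_mul_neg_le (h : StarTuple α) {s : Finset (ZMod m)} (hs : 0 ∉ s) :
    ∑ x ∈ s, eigenDim α x * eigenDim α (-x) ≤ 2 * ((N : ℤ) - 3) := by
  have h1 : ∑ x ∈ s, eigenDim α x * eigenDim α (-x) ≤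
      ∑ x ∈ univ.erase (0 : ZMod m), eigenDim α x * eigenDim α (-x) := by
    refine Finset.sum_le_sum_of_subset_of_nonneg (fun x hx => ?_) fun x hx _ => ?_
    · simp only [mem_erase, mem_univ, and_true]
      rintro rfl
      exact hs hx
    · exact h.mul_neg_nonneg (ne_of_mem_erase hx)
  have h2 : 0 ≤ ∑ x ∈ univ.erase (0 : ZMod m) with x = -x, eigenDim α x :=
    Finset.sum_nonneg fun x hx => h.eigenDim_nonneg (ne_of_mem_erase (mem_filter.1 hx).1)
  linarith [h.star]

omit [NeZero m] in
theorem natCast_ne_zero {n : ℕ} (h1 : 0 < n) (h2 : n < m) : (n : ZMod m) ≠ 0 := by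
  rw [Ne, ZMod.natCast_eq_zero_iff]
  exact fun h => absurd (Nat.le_of_dvd h1 h) (by omega)

/-- The contribution of the pair `±n` to (⋆). -/
theorem single_le (h : StarTuple α) {n : ℕ} (hn : 0 < n) (hn' : 2 * n < m) :
    eigenDim α n * eigenDim α (-n) ≤ (N : ℤ) - 3 := by
  have e1 : (n : ZMod m) ≠ -n := by
    rw [Ne, eq_neg_iff_add_eq_zero]
    exact_mod_cast natCast_ne_zero (m := m) (n := n + n) (by omega) (by omega)
  have e0 : (n : ZMod m) ≠ 0 := natCast_ne_zero (by omega) (by omega)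
  have := h.sum_mul_neg_le (s := {(n : ZMod m), -(n : ZMod m)})
    (by simp [e0.symm, eq_comm (a := (0 : ZMod m)), e0])
  rw [Finset.sum_pair e1, neg_neg, mul_comm (eigenDim α (-n))] at this
  linarith

theorem pair_le (h : StarTuple α) {n k : ℕ} (hn : 0 < n) (hnk : n < k) (hk : 2 * k < m) :
    eigenDim α n * eigenDim α (-n) + eigenDim α k * eigenDim α (-k) ≤ (N : ℤ) - 3 := by
  have e0 : ∀ j : ℕ, 0 < j → j < m → (j : ZMod m) ≠ 0 := fun j => natCast_ne_zero
  have e1 : (n : ZMod m) ≠ -n := by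
    rw [Ne, eq_neg_iff_add_eq_zero]; exact_mod_cast e0 (n + n) (by omega) (by omega)
  have e2 : (k : ZMod m) ≠ -k := by
    rw [Ne, eq_neg_iff_add_eq_zero]; exact_mod_cast e0 (k + k) (by omega) (by omega)
  have e3 : (n : ZMod m) ≠ -k := by
    rw [Ne, eq_neg_iff_add_eq_zero]; exact_mod_cast e0 (n + k) (by omega) (by omega)
  have e4 : (n : ZMod m) ≠ k := by
    intro h
    have := e0 (k - n) (by omega) (by omega)
    rw [Nat.cast_sub hnk.le] at this
    simp [h] at this
  have e5 := e0 n hn (by omega)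
  have e6 := e0 k (by omega) (by omega)
  have := h.sum_mul_neg_le (s := {(n : ZMod m), -(n : ZMod m), (k : ZMod m), -(k : ZMod m)})
    (by simp [eq_comm (a := (0 : ZMod m)), e5, e6])
  rw [Finset.sum_insert, Finset.sum_insert, Finset.sum_pair e2, neg_neg, neg_neg,
    mul_comm (eigenDim α (-n)), mul_comm (eigenDim α (-k))] at this
  · linarith
  · simp only [mem_insert, mem_singleton, not_or]
    exact ⟨fun h => e3 (by rw [← h, neg_neg]), fun h => e4 (neg_injective h)⟩
  · simp only [mem_insert, mem_singleton, not_or]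
    exact ⟨e1, e4, e3⟩

omit [NeZero m] in
theorem sum_intCast_eq_zero {a : Fin N → ℤ} (h : (m : ℤ) ∣ ∑ i, a i) :
    ∑ i, (a i : ZMod m) = 0 := by
  rw [← Int.cast_sum, ZMod.intCast_zmod_eq_zero_iff_dvd]
  exact h

theorem hodgeDim_eq {a : Fin N → ℤ} (h : (m : ℤ) ∣ ∑ i, a i) (n : ℤ) :
    hodgeDim m N a n = eigenDim (fun i => (a i : ZMod m)) (n : ZMod m) := by
  have h3 : (m : ℤ) ≠ 0 := by exact_mod_cast NeZero.ne m
  have hs : ∑ i, (n * a i) % (m : ℤ) = ∑ i, (((n : ZMod m) * (a i : ZMod m)).val : ℤ) := by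
    refine Finset.sum_congr rfl fun i _ => ?_
    rw [← Int.cast_mul, ZMod.val_intCast]
  have hd : (m : ℤ) ∣ ∑ i, (((n : ZMod m) * (a i : ZMod m)).val : ℤ) := by
    rw [← ZMod.intCast_zmod_eq_zero_iff_dvd]
    push_cast
    simp [← Finset.mul_sum, sum_intCast_eq_zero h]
  rw [hodgeDim, hs, eigenDim, Int.cast_sub, Int.cast_div hd (by exact_mod_cast h3)]
  simp

theorem sum_erase_zero (f : ZMod m → ℤ) :
    ∑ x ∈ univ.erase (0 : ZMod m), f x = ∑ n ∈ Icc 1 (m - 1), f (n : ZMod m) := by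
  symm
  have hm := NeZero.pos m
  refine Finset.sum_bij' (fun n _ => (n : ZMod m)) (fun x _ => x.val) ?_ ?_ ?_ ?_ ?_
  · intro n hn
    rw [mem_Icc] at hn
    simpa using natCast_ne_zero (m := m) (n := n) (by omega) (by omega)
  · intro x hx
    have := (ZMod.val_ne_zero x).2 (ne_of_mem_erase hx)
    have := x.val_lt
    rw [mem_Icc]; omega
  · intro n hn
    rw [mem_Icc] at hn
    exact ZMod.val_cast_of_lt (by omega)
  · intro x _
    exact ZMod.natCast_zmod_val x
  · intro n _; rfl

theorem sum_Icc_symm (f : ℕ → ℤ) (hf : ∀ n, 1 ≤ n → n < m → f (m - n) = f n) :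
    ∑ n ∈ Icc 1 (m - 1), f n =
      2 * ∑ n ∈ Icc 1 ((m - 1) / 2), f n + if m % 2 = 0 then f (m / 2) else 0 := by
  have hm := NeZero.pos m
  have hsplit : Icc 1 (m - 1) =
      (Icc 1 ((m - 1) / 2) ∪ Icc (m - (m - 1) / 2) (m - 1)) ∪ {n ∈ Icc 1 (m - 1) | 2 * n = m} := by
    ext n
    simp only [mem_union, mem_Icc, mem_filter]
    omega
  have hrefl : ∑ n ∈ Icc (m - (m - 1) / 2) (m - 1), f n = ∑ n ∈ Icc 1 ((m - 1) / 2), f n := by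
    refine Finset.sum_bij' (fun n _ => m - n) (fun n _ => m - n) ?_ ?_ ?_ ?_ ?_ <;>
      simp only [mem_Icc]
    · omega
    · omega
    · omega
    · omega
    · intro n hn
      exact (hf n (by omega) (by omega)).symm
  have hmid : ∑ n ∈ Icc 1 (m - 1) with 2 * n = m, f n = if m % 2 = 0 then f (m / 2) else 0 := by
    split_ifs with h
    · rw [show {n ∈ Icc 1 (m - 1) | 2 * n = m} = {m / 2} by
        ext n; simp only [mem_filter, mem_Icc, mem_singleton]; omega, sum_singleton]
    · refine Finset.sum_eq_zero fun n hn => ?_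
      simp only [mem_filter, mem_Icc] at hn
      omega
  rw [hsplit, sum_union, sum_union, hrefl, hmid, two_mul]
  · rw [Finset.disjoint_left]; simp only [mem_Icc]; omega
  · rw [Finset.disjoint_left]; simp only [mem_union, mem_Icc, mem_filter]; omega

theorem sum_filter_eq_neg (f : ZMod m → ℤ) :
    ∑ x ∈ univ.erase (0 : ZMod m) with x = -x, f x =
      if m % 2 = 0 then f ((m / 2 : ℕ) : ZMod m) else 0 := by
  have key : ∀ n ∈ Icc 1 (m - 1), ((n : ZMod m) = -n ↔ 2 * n = m) := fun n hn => by
    rw [mem_Icc] at hn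
    rw [eq_neg_iff_add_eq_zero, ← Nat.cast_add, ZMod.natCast_eq_zero_iff]
    refine ⟨fun ⟨c, hc⟩ => ?_, fun h => ⟨1, by omega⟩⟩
    have h0 : 0 < c := Nat.pos_of_ne_zero (by rintro rfl; omega)
    have h2 : c < 2 := lt_of_mul_lt_mul_left (a := m) (by omega) (Nat.zero_le _)
    obtain rfl : c = 1 := by omega
    omega
  rw [sum_filter, sum_erase_zero, sum_congr rfl fun n hn => if_congr (key n hn) rfl rfl,
    ← sum_filter]
  split_ifs with h
  · have := NeZero.pos m
    rw [show {n ∈ Icc 1 (m - 1) | 2 * n = m} = {m / 2} by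
      ext n; simp only [mem_filter, mem_Icc, mem_singleton]; omega, sum_singleton]
  · refine Finset.sum_eq_zero fun n hn => ?_
    simp only [mem_filter, mem_Icc] at hn
    omega

theorem symmetrised_sum_eq (α : Fin N → ZMod m) :
    ∑ x ∈ univ.erase (0 : ZMod m), eigenDim α x * eigenDim α (-x) +
      ∑ x ∈ univ.erase (0 : ZMod m) with x = -x, eigenDim α x =
    2 * ∑ n ∈ Icc 1 ((m - 1) / 2), eigenDim α n * eigenDim α (-n) +
      if m % 2 = 0 then eigenDim α (m / 2 : ℕ) * (eigenDim α (m / 2 : ℕ) + 1) else 0 := by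
  have hneg : m % 2 = 0 → -((m / 2 : ℕ) : ZMod m) = ((m / 2 : ℕ) : ZMod m) := fun h => by
    rw [neg_eq_iff_add_eq_zero, ← Nat.cast_add, ZMod.natCast_eq_zero_iff]
    exact ⟨1, by omega⟩
  rw [sum_filter_eq_neg, sum_erase_zero, sum_Icc_symm]
  · split_ifs with h
    · rw [hneg h]; ring
    · ring
  · intro n h1 h2
    rw [Nat.cast_sub h2.le]
    simp [mul_comm]

theorem of_condStar {a : Fin N → ℤ} (ht : IsTriple m N a) (hs : CondStar m N a) :
    StarTuple fun i => (a i : ZMod m) := by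
  obtain ⟨h2, h4, ha, hg, hd⟩ := ht
  have hm := NeZero.pos m
  refine ⟨h4, fun i => ?_, sum_intCast_eq_zero hd, fun x hx => ?_, ?_⟩
  · rw [Ne, ZMod.intCast_zmod_eq_zero_iff_dvd]
    intro h
    have := Int.le_of_dvd (by linarith [(ha i).1]) h
    linarith [(ha i).2]
  · by_contra! hc
    refine hx ?_
    rw [← ZMod.natCast_zmod_val x, ZMod.natCast_eq_zero_iff]
    have h1 : (m : ℤ) ∣ x.val * univ.gcd a := by
      have : (m : ℤ) ∣ univ.gcd fun i => (x.val : ℤ) * a i := by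
        refine Finset.dvd_gcd fun i _ => ?_
        rw [← ZMod.intCast_zmod_eq_zero_iff_dvd]
        simpa using hc i
      rw [Finset.gcd_mul_left] at this
      exact (this.trans (mul_dvd_mul_right (normalize_associated _).dvd _))
    have h5 : IsCoprime (m : ℤ) (univ.gcd a) := Int.isCoprime_iff_gcd_eq_one.2 hg
    exact_mod_cast h5.dvd_of_dvd_mul_right h1
  · set β : Fin N → ZMod m := fun i => (a i : ZMod m) with hβ
    rw [symmetrised_sum_eq]
    have hs' : (N : ℚ) - 3 = (∑ n ∈ Icc 1 ((m - 1) / 2), eigenDim β n * eigenDim β (-n) : ℤ) +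
        if m % 2 = 0 then
          (eigenDim β ((m / 2 : ℕ) : ZMod m) : ℚ) * (eigenDim β ((m / 2 : ℕ) : ZMod m) + 1) / 2
        else 0 := by
      have hhalf : (((m : ℤ) / 2 : ℤ) : ZMod m) = ((m / 2 : ℕ) : ZMod m) := by
        rw [← Int.cast_natCast (m / 2)]
        push_cast
        rfl
      rw [hs]
      simp only [hodgeDim_eq hd, hhalf]
      push_cast
      simp [hβ]
    rw [← @Int.cast_inj ℚ]
    split_ifs at hs' ⊢ <;>
    · push_cast at hs' ⊢
      linarith

theorem sum_hodgeDim_eq {a : Fin N → ℤ} (h : (m : ℤ) ∣ ∑ i, a i) :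
    ∑ n ∈ Icc 1 (m - 1), hodgeDim m N a n = totalDim fun i => (a i : ZMod m) := by
  rw [totalDim, sum_erase_zero]
  push_cast
  exact Finset.sum_congr rfl fun n _ => by rw [hodgeDim_eq h]; simp

theorem eigenDim_unit_add_neg (h : StarTuple α) (u : (ZMod m)ˣ) :
    eigenDim α u + eigenDim α (-u) = (N : ℤ) - 2 := by
  rw [h.eigenDim_add_neg]
  simp [h.ne_zero]

omit [NeZero m] in
theorem exists_coprime (h2 : 2 ≤ m) (hm : m ≠ 2 ∧ m ≠ 3 ∧ m ≠ 4 ∧ m ≠ 6) :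
    ∃ k, 1 < k ∧ 2 * k < m ∧ k.Coprime m := by
  obtain h | h | h : m % 2 = 1 ∨ m % 4 = 0 ∨ m % 4 = 2 := by omega
  · exact ⟨2, by omega, by omega, (Nat.coprime_two_left).2 (Nat.odd_iff.2 h)⟩
  · refine ⟨m / 2 - 1, by omega, by omega, ?_⟩
    obtain ⟨q, rfl⟩ : ∃ q, m = 4 * q + 4 := ⟨m / 4 - 1, by omega⟩
    have e : (4 * q + 4) / 2 - 1 = 2 * q + 1 := by omega
    rw [e, show 4 * q + 4 = 2 + 2 * (2 * q + 1) by ring, Nat.coprime_add_mul_right_right,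
      Nat.coprime_two_right]
    exact odd_two_mul_add_one q
  · refine ⟨m / 2 - 2, by omega, by omega, ?_⟩
    obtain ⟨q, rfl⟩ : ∃ q, m = 4 * q + 6 := ⟨m / 4 - 1, by omega⟩
    have e : (4 * q + 6) / 2 - 2 = 2 * q + 1 := by omega
    rw [e, show 4 * q + 6 = 2 ^ 2 + 2 * (2 * q + 1) by ring, Nat.coprime_add_mul_right_right]
    exact Nat.Coprime.pow_right 2 ((Nat.coprime_two_right).2 (odd_two_mul_add_one q))

theorem exists_unit_eigenDim_eq_zero (h : StarTuple α) (h2 : 2 ≤ m)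
    (hm : m ≠ 2 ∧ m ≠ 3 ∧ m ≠ 4 ∧ m ≠ 6) : ∃ u : (ZMod m)ˣ, eigenDim α u = 0 := by
  by_contra! hc
  obtain ⟨k, hk1, hk2, hk⟩ := exists_coprime h2 hm
  have : Fact (1 < m) := ⟨h2⟩
  have key : ∀ u : (ZMod m)ˣ, (N : ℤ) - 3 ≤ eigenDim α u * eigenDim α (-u) := fun u => by
    have e1 := h.eigenDim_nonneg u.ne_zero
    have e2 := h.eigenDim_nonneg (-u).ne_zero
    have e3 := hc u
    have e4 := hc (-u)
    have e5 := h.eigenDim_unit_add_neg u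
    rw [Units.val_neg] at e2 e4
    nlinarith [mul_nonneg (show 0 ≤ eigenDim α u - 1 by omega)
      (show 0 ≤ eigenDim α (-u) - 1 by omega)]
  have a1 := key 1
  have a2 := key (ZMod.unitOfCoprime k hk)
  have a3 := h.pair_le (n := 1) one_pos hk1 hk2
  rw [ZMod.coe_unitOfCoprime] at a2
  simp only [Nat.cast_one, Units.val_one] at a1 a3
  have := h.four_le
  omega

theorem exists_unit_sum_val (h : StarTuple α) (h2 : 2 ≤ m) : ∃ u : (ZMod m)ˣ,
    ∑ i, ((u : ZMod m) * α i).val = m ∨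
    (m, ∑ i, ((u : ZMod m) * α i).val) ∈ [(2, 4), (2, 6), (3, 6), (4, 8), (6, 12)] := by
  have : Fact (1 < m) := ⟨h2⟩
  have key : ∀ (u : (ZMod m)ˣ) (d : ℕ), eigenDim α u = d →
      ∑ i, ((u : ZMod m) * α i).val = m * (d + 1) := fun u d hd => by
    have := h.mul_eigenDim_add_one u
    rw [hd] at this
    exact_mod_cast this.symm
  by_cases hm : m ≠ 2 ∧ m ≠ 3 ∧ m ≠ 4 ∧ m ≠ 6
  · obtain ⟨u, hu⟩ := h.exists_unit_eigenDim_eq_zero h2 hm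
    exact ⟨u, Or.inl (by simpa using key u 0 (by simpa using hu))⟩
  have e1 := h.eigenDim_nonneg (1 : (ZMod m)ˣ).ne_zero
  have e2 := h.eigenDim_nonneg (-1 : (ZMod m)ˣ).ne_zero
  have e5 := h.eigenDim_unit_add_neg 1
  rw [← Units.val_neg] at e5
  by_cases hm2 : m = 2
  · subst hm2
    have hs := h.star
    have hu : (univ.erase (0 : ZMod 2)) = {1} := by
      ext x
      simp only [mem_erase, mem_univ, and_true, mem_singleton]
      revert x
      decide
    have hn : (-1 : ZMod 2) = 1 := by decide
    rw [sum_filter, hu, sum_singleton, sum_singleton, if_pos hn.symm, hn] at hs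
    simp only [Units.val_neg, Units.val_one, hn] at e1 e5
    have : (eigenDim α 1 - 1) * (eigenDim α 1 - 2) = 0 := by linarith
    rcases mul_eq_zero.1 this with h0 | h0
    · exact ⟨1, Or.inr (by rw [key 1 1 (by simp only [Units.val_one]; push_cast; omega)]; simp)⟩
    · exact ⟨1, Or.inr (by rw [key 1 2 (by simp only [Units.val_one]; push_cast; omega)]; simp)⟩
  obtain ⟨u, d, hd, hu⟩ : ∃ (u : (ZMod m)ˣ) (d : ℕ), d ≤ 1 ∧ eigenDim α u = d := by
    by_contra! hc
    have c : ∀ u : (ZMod m)ˣ, eigenDim α u ≠ 0 ∧ eigenDim α u ≠ 1 := fun u =>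
      ⟨by exact_mod_cast hc u 0 (by simp), by exact_mod_cast hc u 1 le_rfl⟩
    have c1 := c 1
    have c2 := c (-1)
    have := h.single_le (n := 1) one_pos (by omega)
    rw [Nat.cast_one, ← Units.val_one, ← Units.val_neg] at this
    have d1 : 0 ≤ eigenDim α ((1 : (ZMod m)ˣ) : ZMod m) - 2 := by omega
    have d2 : 0 ≤ eigenDim α ((-1 : (ZMod m)ˣ) : ZMod m) - 2 := by omega
    nlinarith [mul_nonneg d1 d2]
  refine ⟨u, ?_⟩
  rw [key u d hu]
  interval_cases d
  · simp
  · right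
    obtain rfl | rfl | rfl : m = 3 ∨ m = 4 ∨ m = 6 := by omega
    all_goals simp

end StarTuple

/-- Numerical form of `d_n = 1`, `d_{-n} = N - 3`, in terms of the four largest weights. -/
def FullAt (m N a b c d n : ℕ) : Prop :=
  ∃ k₁ k₂ k₃ k₄ : ℕ, k₁ * m < n * a ∧ n * a < (k₁ + 1) * m ∧ k₂ * m < n * b ∧
    n * b < (k₂ + 1) * m ∧ k₃ * m < n * c ∧ n * c < (k₃ + 1) * m ∧ k₄ * m < n * d ∧
    n * d < (k₄ + 1) * m ∧ (k₄ = 0 ∨ N = 4) ∧ k₁ + k₂ + k₃ + k₄ + 2 = n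

/-- Numerical form of `0 < d_n` and `0 < d_{-n}`, in terms of the four largest weights. -/
def PosAt (m N a b c d n : ℕ) : Prop :=
  ∃ g k₁ k₂ k₃ k₄ : ℕ, g ≤ 1 ∧ (g = 1 ∨ k₁ * m < n * a) ∧ k₁ * m ≤ n * a ∧
    n * a < (k₁ + 1) * m ∧ k₂ * m < n * b ∧ n * b < (k₂ + 1) * m ∧ k₃ * m < n * c ∧
    n * c < (k₃ + 1) * m ∧ k₄ * m < n * d ∧ n * d < (k₄ + 1) * m ∧ (k₄ = 0 ∨ N = 4) ∧
    k₁ + k₂ + k₃ + k₄ + 2 ≤ n ∧ n + g + 2 ≤ N + (k₁ + k₂ + k₃ + k₄)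

section weights

variable {m N a b c d : ℕ}

theorem not_two_full_of_small_gap (hd : 0 < d) (hdc : d ≤ c) (hcb : c ≤ b)
    {B C : ℕ} (hB : a + B = m) (hC : b + C = B) (hcd : c + d ≤ C) (hBm : 2 * B ≤ m)
    (hCB : C * (2 * m + B) ≤ B * (m - B)) :
    ∃ n k, n < k ∧ 2 * k < m ∧ FullAt m N a b c d n ∧ FullAt m N a b c d k := by
  have hB0 : 0 < B := by omega
  have hmC : 0 < m * C := Nat.mul_pos (by omega) (by omega)
  set k := (B * B - 1) / (m * C) + 1 with hk
  have hBB : 0 < B * B := Nat.mul_pos hB0 hB0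
  have hk1 : B * B ≤ k * (m * C) := by
    have := Nat.lt_div_mul_add hmC (a := B * B - 1)
    rw [hk, add_mul]; omega
  have hk2 : (k - 1) * (m * C) < B * B := by
    have := Nat.div_mul_le_self (B * B - 1) (m * C)
    rw [hk, Nat.add_sub_cancel]; omega
  have hk0 : 1 ≤ k := Nat.le_add_left _ _
  have full : ∀ n l, k ≤ l → l ≤ k + 1 → l * m < n * B → n * B ≤ l * m + B →
      2 * n < m ∧ FullAt m N a b c d n := by
    intro n l hl1 hl2 h1 h2
    obtain ⟨l, rfl⟩ : ∃ l', l = l' + 1 := ⟨l - 1, by omega⟩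
    have hnC : B < n * C := by
      have : B * B < n * C * B := by
        calc B * B ≤ k * (m * C) := hk1
          _ ≤ (l + 1) * (m * C) := Nat.mul_le_mul_right _ hl1
          _ = (l + 1) * m * C := by ring
          _ < n * B * C := Nat.mul_lt_mul_of_pos_right h1 (by omega)
          _ = n * C * B := by ring
      exact lt_of_mul_lt_mul_right this (Nat.zero_le _)
    have hnm : n * C < m := by
      have e1 : n * C * B ≤ ((k + 1) * m + B) * C := by
        calc n * C * B = n * B * C := by ring
          _ ≤ ((l + 1) * m + B) * C := Nat.mul_le_mul_right _ h2
          _ ≤ _ := by gcongr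
      have e2 : n * C * B < m * B := by
        zify [hk0, show B ≤ m by omega] at e1 hk2 hCB ⊢
        nlinarith only [e1, hk2, hCB]
      exact lt_of_mul_lt_mul_right e2 (Nat.zero_le _)
    have hn0 : 0 < n := Nat.pos_of_ne_zero (by rintro rfl; simp at h1)
    have e3 : n * c + n * d ≤ n * C := by rw [← mul_add]; exact Nat.mul_le_mul_left _ hcd
    have e4 : 0 < n * d := Nat.mul_pos hn0 hd
    have e5 : n * d ≤ n * c := Nat.mul_le_mul_left _ hdc
    have e6 : n * b + n * C = n * B := by rw [← mul_add, hC]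
    have e7 : n * a + n * B = n * m := by rw [← mul_add, hB]
    have e8 : 2 * n ≤ n * C := by rw [mul_comm]; exact Nat.mul_le_mul_left _ (by omega)
    have e9 : l + 2 ≤ n := by
      by_contra! hc
      have : n * B ≤ (l + 1) * m := Nat.mul_le_mul (by omega) (by omega)
      omega
    obtain ⟨r, hr⟩ : ∃ r, n = r + (l + 2) := ⟨n - (l + 2), by omega⟩
    have e10 : n * m = r * m + l * m + 2 * m := by rw [hr]; ring
    rw [add_mul, one_mul] at h1 h2
    refine ⟨by omega, r, l, 0, 0, ?_, ?_, ?_, ?_, ?_, ?_, ?_, ?_, Or.inl rfl, by omega⟩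
    all_goals (try simp only [add_mul, one_mul, zero_mul, zero_add]); omega
  have bd : ∀ l, l * m < (l * m / B + 1) * B ∧ (l * m / B + 1) * B ≤ l * m + B := fun l => by
    have := Nat.lt_div_mul_add hB0 (a := l * m)
    have := Nat.div_mul_le_self (l * m) B
    rw [add_mul]; omega
  obtain ⟨f1, f2⟩ := full _ k le_rfl (by omega) (bd k).1 (bd k).2
  obtain ⟨f3, f4⟩ := full _ (k + 1) (by omega) le_rfl (bd (k + 1)).1 (bd (k + 1)).2
  refine ⟨_, _, ?_, f3, f2, f4⟩
  refine lt_of_mul_lt_mul_right (a := B) ?_ (Nat.zero_le _)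
  have := (bd k).2
  have := (bd (k + 1)).1
  rw [add_mul (k : ℕ) 1 m] at this ⊢
  omega

theorem not_two_full_of_small_second (hm : 12 < m) (hd : 0 < d) (hdc : d ≤ c) (hcb : c ≤ b)
    {B : ℕ} (hB : a + B = m) (hcd : b + c + d ≤ B) (hBm : 2 * B < m)
    (hCB : (m + 2 * B) * b < m * B) :
    ∃ n k, n < k ∧ 2 * k < m ∧ FullAt m N a b c d n ∧ FullAt m N a b c d k := by
  have hB0 : 0 < B := by omega
  have full : ∀ n, m < n * B → n * B ≤ m + 2 * B → 2 * n < m ∧ FullAt m N a b c d n := by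
    intro n h1 h2
    have e1 : n * b < m := by
      have : n * b * B < m * B := by
        calc n * b * B = n * B * b := by ring
          _ ≤ (m + 2 * B) * b := Nat.mul_le_mul_right _ h2
          _ < _ := hCB
      exact lt_of_mul_lt_mul_right this (Nat.zero_le _)
    have hn0 : 2 ≤ n := by
      by_contra! hc
      have : n * B ≤ 1 * B := Nat.mul_le_mul_right _ (by omega)
      omega
    have e2 : n * c ≤ n * b := Nat.mul_le_mul_left _ hcb
    have e4 : 0 < n * d := Nat.mul_pos (by omega) hd
    have e5 : n * d ≤ n * c := Nat.mul_le_mul_left _ hdc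
    have e7 : n * a + n * B = n * m := by rw [← mul_add, hB]
    have e8 : 2 * n < m := by
      obtain ⟨n, rfl⟩ : ∃ n', n = n' + 2 := ⟨n - 2, by omega⟩
      have : n * 3 ≤ n * B := Nat.mul_le_mul_left _ (by omega)
      rw [add_mul] at h2
      omega
    obtain ⟨r, hr⟩ : ∃ r, n = r + 2 := ⟨n - 2, by omega⟩
    have e10 : n * m = r * m + 2 * m := by rw [hr]; ring
    refine ⟨e8, r, 0, 0, 0, ?_, ?_, ?_, ?_, ?_, ?_, ?_, ?_, Or.inl rfl, by omega⟩
    all_goals (try simp only [add_mul, one_mul, zero_mul, zero_add]); omega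
  have h1 := Nat.lt_div_mul_add hB0 (a := m)
  have h2 := Nat.div_mul_le_self m B
  obtain ⟨f1, f2⟩ := full (m / B + 1) (by rw [add_mul]; omega) (by rw [add_mul]; omega)
  obtain ⟨f3, f4⟩ := full (m / B + 2) (by rw [add_mul]; omega) (by rw [add_mul]; omega)
  exact ⟨_, _, by omega, f3, f2, f4⟩

theorem gap_bounds (hm : 12 < m) (hd : 0 < d) (hdc : d ≤ c) (hcb : c ≤ b)
    {B C : ℕ} (hB : a + B = m) (hC : b + C = B) (hcd : c + d ≤ C) (hBm : 2 * B ≤ m)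
    (no : ∀ n k, n < k → 2 * k < m → FullAt m N a b c d n → ¬FullAt m N a b c d k) :
    m < 4 * B ∧ m < 12 * C := by
  have l2 : B * (m - B) < C * (2 * m + B) := by
    by_contra! hc
    obtain ⟨n, k, h1, h2, h3, h4⟩ :=
      not_two_full_of_small_gap (N := N) hd hdc hcb hB hC hcd hBm hc
    exact no n k h1 h2 h3 h4
  have hB0 : 0 < B := by omega
  have hb : m < 4 * B := by
    rcases hBm.eq_or_lt with h | h
    · omega
    have l1 : m * B ≤ (m + 2 * B) * b := by
      by_contra! hc
      obtain ⟨n, k, h1, h2, h3, h4⟩ :=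
        not_two_full_of_small_second (N := N) hm hd hdc hcb hB (by omega) h hc
      exact no n k h1 h2 h3 h4
    by_contra! hc
    subst hC
    zify [show b + C ≤ m by omega] at *
    have e1 : (m + 2 * (b + C) : ℤ) * C ≤ 2 * (b + C) * (b + C) := by nlinarith
    have e2 : (m + 2 * (b + C) : ℤ) * ((b + C) * (m - (b + C))) <
      (m + 2 * (b + C)) * (C * (2 * m + (b + C))) := by
      refine mul_lt_mul_of_pos_left l2 (by positivity)
    have e3 : (m + 2 * (b + C) : ℤ) * C * (2 * m + (b + C)) ≤
        2 * (b + C) * (b + C) * (2 * m + (b + C)) :=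
      mul_le_mul_of_nonneg_right e1 (by positivity)
    have e4 : (b + C : ℤ) * ((m + 2 * (b + C)) * (m - (b + C))) <
      (b + C) * (2 * (b + C) * (2 * m + (b + C))) := by nlinarith
    have e5 := lt_of_mul_lt_mul_left e4 hB0.le
    nlinarith
  refine ⟨hb, ?_⟩
  by_contra! hc
  have e1 : 12 * C * (2 * m + B) ≤ m * (2 * m + B) := Nat.mul_le_mul_right _ hc
  zify [show B ≤ m by omega] at *
  nlinarith

end weights

/-- No pair of distinct characters in the lower half violates (⋆). -/
def NoPair (m N a b c d : ℕ) : Prop :=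
  ∀ n k, n ≠ k → 2 * n < m → 2 * k < m → FullAt m N a b c d n → ¬PosAt m N a b c d k

section weights

variable {m N a b c d : ℕ}

theorem FullAt.posAt {n : ℕ} (hN : 4 ≤ N) (h : FullAt m N a b c d n) : PosAt m N a b c d n := by
  obtain ⟨k₁, k₂, k₃, k₄, h1, h1', h2, h2', h3, h3', h4, h4', h0, h5⟩ := h
  exact ⟨0, k₁, k₂, k₃, k₄, by omega, Or.inr h1, h1.le, h1', h2, h2', h3, h3', h4, h4', h0,
    by omega, by omega⟩

namespace NoPair

theorem of_full (no : NoPair m N a b c d) (hN : 4 ≤ N) (n k₁ k₂ k₃ k₄ n' l₁ l₂ l₃ l₄ : ℕ)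
    (h : n ≠ n' ∧ 2 * n < m ∧ 2 * n' < m)
    (h1 : k₁ * m < n * a ∧ n * a < (k₁ + 1) * m ∧ k₂ * m < n * b ∧
      n * b < (k₂ + 1) * m ∧ k₃ * m < n * c ∧ n * c < (k₃ + 1) * m ∧ k₄ * m < n * d ∧
      n * d < (k₄ + 1) * m ∧ (k₄ = 0 ∨ N = 4) ∧ k₁ + k₂ + k₃ + k₄ + 2 = n)
    (h2 : l₁ * m < n' * a ∧ n' * a < (l₁ + 1) * m ∧ l₂ * m < n' * b ∧
      n' * b < (l₂ + 1) * m ∧ l₃ * m < n' * c ∧ n' * c < (l₃ + 1) * m ∧ l₄ * m < n' * d ∧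
      n' * d < (l₄ + 1) * m ∧ (l₄ = 0 ∨ N = 4) ∧ l₁ + l₂ + l₃ + l₄ + 2 = n') : False :=
  no n n' h.1 h.2.1 h.2.2 ⟨k₁, k₂, k₃, k₄, h1⟩ (FullAt.posAt hN ⟨l₁, l₂, l₃, l₄, h2⟩)

/-- The case where every weight is less than half of the total. -/
theorem le_of_two_mul_lt (no : NoPair m N a b c d) (hN : 4 ≤ N) (hd : 0 < d) (hdc : d ≤ c)
    (hcb : c ≤ b) (hba : b ≤ a) (hs : a + b + c + d ≤ m) (hs4 : N = 4 → a + b + c + d = m)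
    (ha : 2 * a < m) : m ≤ 22 := by
  by_contra! hm
  have f := no.of_full hN 2 0 0 0 0
  rcases lt_or_ge (3 * b) m with hb | hb
  swap
  · rcases lt_or_ge (4 * c) m with hc | hc
    · exact f 4 1 1 0 0 (by omega) (by omega) (by omega)
    rcases lt_or_ge (5 * a) (2 * m) with h | h
    · exact f 5 1 1 1 0 (by omega) (by omega) (by omega)
    · exact f 7 2 2 1 0 (by omega) (by omega) (by omega)
  obtain ⟨hN4, ha3⟩ : N = 4 ∧ 3 * a ≤ m := by
    by_contra! hc
    rcases lt_trichotomy (3 * a) m with h | h | h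
    · exact no 2 3 (by omega) (by omega) (by omega) ⟨0, 0, 0, 0, by omega⟩
        ⟨0, 0, 0, 0, 0, by omega⟩
    · exact no 2 3 (by omega) (by omega) (by omega) ⟨0, 0, 0, 0, by omega⟩
        ⟨1, 1, 0, 0, 0, by omega⟩
    · exact f 3 1 0 0 0 (by omega) (by omega) (by omega)
  rcases ha3.lt_or_eq with ha3 | ha3
  · rcases lt_or_ge m (6 * d) with h | h
    · exact f 6 1 1 1 1 (by omega) (by omega) (by omega)
    rcases lt_or_ge (4 * c) m with h3 | h3
    · exact f 4 1 1 0 0 (by omega) (by omega) (by omega)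
    · exact f 5 1 1 1 0 (by omega) (by omega) (by omega)
  rcases lt_or_ge m (4 * b) with h | h
  · rcases lt_or_ge (4 * c) m with h3 | h3
    · exact f 4 1 1 0 0 (by omega) (by omega) (by omega)
    · exact f 5 1 1 1 0 (by omega) (by omega) (by omega)
  rcases lt_or_ge (5 * d) m with h3 | h3
  · exact f 5 1 1 1 0 (by omega) (by omega) (by omega)
  · exact f 7 2 1 1 1 (by omega) (by omega) (by omega)

/-- The case where one weight is at least half of the total. -/
theorem le_of_le_two_mul (no : NoPair m N a b c d) (hN : 4 ≤ N) (hd : 0 < d) (hdc : d ≤ c)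
    (hcb : c ≤ b) (hba : b ≤ a) (hs : a + b + c + d ≤ m) (hs4 : N = 4 → a + b + c + d = m)
    (ha : m ≤ 2 * a) : m ≤ 22 := by
  by_contra! hm
  obtain ⟨hB, hC⟩ := gap_bounds (m := m) (N := N) (B := m - a) (C := m - a - b) (by omega) hd hdc
    hcb (by omega) (by omega) (by omega) (by omega)
    fun n k h1 h2 h3 h4 => no n k h1.ne (by omega) h2 h3 (h4.posAt hN)
  rcases lt_or_ge (3 * a) (2 * m) with ha3 | ha3
  swap
  · have f := no.of_full hN 4 2 0 0 0
    rcases lt_or_ge (5 * b) m with h | h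
    · exact f 5 3 0 0 0 (by omega) (by omega) (by omega)
    rcases lt_or_ge (7 * a) (5 * m) with h | h
    · exact f 7 4 1 0 0 (by omega) (by omega) (by omega)
    · exact f 9 6 1 0 0 (by omega) (by omega) (by omega)
  rcases lt_or_ge (3 * b) m with hb | hb
  swap
  · rcases le_or_gt (2 * m) (5 * b) with h | h
    · exact no.of_full hN 7 3 2 0 0 9 4 3 0 0 (by omega) (by omega) (by omega)
    have f := no.of_full hN 5 2 1 0 0
    rcases lt_or_ge (7 * a) (4 * m) with h | h
    · rcases lt_or_ge (7 * c) m with h | h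
      · exact f 7 3 2 0 0 (by omega) (by omega) (by omega)
      · exact f 11 5 3 1 0 (by omega) (by omega) (by omega)
    · exact f 8 4 2 0 0 (by omega) (by omega) (by omega)
  have f := no.of_full hN 3 1 0 0 0
  rcases lt_or_ge (4 * b) m with h4 | h4
  · rcases ha.lt_or_eq with h | h
    · exact f 4 2 0 0 0 (by omega) (by omega) (by omega)
    rcases eq_or_ne N 4 with hN4 | hN4
    swap
    · exact no 3 4 (by omega) (by omega) (by omega) ⟨1, 0, 0, 0, by omega⟩
        ⟨1, 2, 0, 0, 0, by omega⟩
    rcases le_or_gt m (5 * c) with h5 | h5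
    · exact f 7 3 1 1 0 (by omega) (by omega) (by omega)
    rcases lt_or_ge m (5 * b) with h6 | h6
    · exact f 5 2 1 0 0 (by omega) (by omega) (by omega)
    rcases lt_or_ge (7 * d) m with h7 | h7
    · exact f 7 3 1 1 0 (by omega) (by omega) (by omega)
    · exact f 9 4 1 1 1 (by omega) (by omega) (by omega)
  rcases le_or_gt m (5 * c) with h5 | h5
  · rcases lt_or_ge (7 * b) (2 * m) with h6 | h6
    · exact f 7 3 1 1 0 (by omega) (by omega) (by omega)
    · exact f 9 4 2 1 0 (by omega) (by omega) (by omega)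
  rcases lt_or_ge (5 * a) (3 * m) with h6 | h6
  · exact f 5 2 1 0 0 (by omega) (by omega) (by omega)
  rcases lt_or_ge (7 * b) (2 * m) with h7 | h7
  · rcases lt_or_ge (7 * c) m with h8 | h8
    · exact f 7 4 1 0 0 (by omega) (by omega) (by omega)
    · exact f 11 6 2 1 0 (by omega) (by omega) (by omega)
  rcases lt_or_ge (8 * a) (5 * m) with h8 | h8
  · exact f 8 4 2 0 0 (by omega) (by omega) (by omega)
  · exact f 10 6 2 0 0 (by omega) (by omega) (by omega)

end NoPair

end weights

namespace StarTuple

variable {m N r : ℕ} [NeZero m] {α : Fin N → ZMod m}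

omit [NeZero m] in
theorem eigenDim_comp_perm (σ : Equiv.Perm (Fin N)) (x : ZMod m) :
    eigenDim (α ∘ σ) x = eigenDim α x := by
  simp only [eigenDim, Function.comp_apply]
  rw [Equiv.sum_comp σ fun i => ((x * α i).val : ℤ)]

theorem comp_perm (h : StarTuple α) (σ : Equiv.Perm (Fin N)) : StarTuple (α ∘ σ) where
  four_le := h.four_le
  ne_zero i := h.ne_zero (σ i)
  sum_eq_zero := (Equiv.sum_comp σ α).trans h.sum_eq_zero
  faithful x hx := by
    obtain ⟨i, hi⟩ := h.faithful x hx
    exact ⟨σ.symm i, by simpa using hi⟩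
  star := by simpa only [eigenDim_comp_perm] using h.star

theorem exists_antitone_perm (v : Fin N → ℕ) : ∃ σ : Equiv.Perm (Fin N), Antitone (v ∘ σ) := by
  have h := Tuple.monotone_sort fun i => OrderDual.toDual (v i)
  exact ⟨_, fun i j hij => h hij⟩

theorem eigenDim_natCast (h : StarTuple α) (hs : ∑ i, (α i).val = m) (n : ℕ) :
    eigenDim α n = n - 1 - ((∑ i, n * (α i).val / m : ℕ) : ℤ) := by
  have h1 := h.mul_eigenDim_add_one n
  have h2 : ∑ i, ((n : ZMod m) * α i).val + m * ∑ i, n * (α i).val / m = m * n := by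
    refine Eq.trans ?_ ((Finset.mul_sum univ (fun i => (α i).val) n).symm.trans
      ((congrArg (n * ·) hs).trans (mul_comm n m)))
    rw [mul_sum, ← sum_add_distrib]
    refine sum_congr rfl fun i _ => ?_
    rw [ZMod.val_mul, ZMod.val_natCast, Nat.mod_mul_mod, Nat.mod_add_div]
  have h3 : (m : ℤ) ≠ 0 := by exact_mod_cast NeZero.ne m
  have h4 : (m : ℤ) * (eigenDim α n + 1 + (∑ i, n * (α i).val / m : ℕ)) = m * n := by
    rw [mul_add, h1]
    exact_mod_cast h2
  have := mul_left_cancel₀ h3 h4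
  omega

theorem natCast_mul_ne_zero (x : ZMod m) {n k : ℕ} (h1 : k * m < n * x.val)
    (h2 : n * x.val < (k + 1) * m) : (n : ZMod m) * x ≠ 0 := by
  rw [← ZMod.natCast_zmod_val x, ← Nat.cast_mul, Ne, ZMod.natCast_eq_zero_iff]
  rintro ⟨c, hc⟩
  rw [hc, mul_comm m] at h1 h2
  have := lt_of_mul_lt_mul_right h1 (Nat.zero_le _)
  have := lt_of_mul_lt_mul_right h2 (Nat.zero_le _)
  omega

theorem sum_univ_add_four (f : Fin (r + 4) → ℕ) :
    ∑ i, f i = f 0 + (f 1 + (f 2 + (f 3 + ∑ i : Fin r, f i.succ.succ.succ.succ))) := by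
  rw [Fin.sum_univ_succ, Fin.sum_univ_succ, Fin.sum_univ_succ, Fin.sum_univ_succ]
  rfl

theorem eigenDim_bounds {α : Fin (r + 4) → ZMod m} (h : StarTuple α)
    (hs : ∑ i, (α i).val = m) (ha : Antitone fun i => (α i).val) {n g k₁ k₂ k₃ k₄ : ℕ}
    (hn : 0 < n) (hg : g = 1 ∨ k₁ * m < n * (α 0).val)
    (h1 : k₁ * m ≤ n * (α 0).val) (h1' : n * (α 0).val < (k₁ + 1) * m)
    (h2 : k₂ * m < n * (α 1).val) (h2' : n * (α 1).val < (k₂ + 1) * m)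
    (h3 : k₃ * m < n * (α 2).val) (h3' : n * (α 2).val < (k₃ + 1) * m)
    (h4 : k₄ * m < n * (α 3).val) (h4' : n * (α 3).val < (k₄ + 1) * m)
    (h0 : k₄ = 0 ∨ r + 4 = 4) :
    eigenDim α n = n - 1 - (k₁ + k₂ + k₃ + k₄) ∧
      ((r + 4 : ℕ) : ℤ) - 2 - g - eigenDim α n ≤ eigenDim α (-n) := by
  have rest : ∀ i : Fin r, 0 * m < n * (α i.succ.succ.succ.succ).val ∧
      n * (α i.succ.succ.succ.succ).val < (0 + 1) * m := fun i => by
    obtain rfl | h0 := h0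
    · rw [zero_mul]
      have : (α i.succ.succ.succ.succ).val ≤ (α 3).val :=
        ha (show (3 : Fin (r + 4)) ≤ i.succ.succ.succ.succ by
          rw [Fin.le_def]; exact (Nat.mod_le _ _).trans (by simp only [Fin.val_succ]; omega))
      exact ⟨Nat.mul_pos hn (Nat.pos_of_ne_zero ((ZMod.val_ne_zero _).2 (h.ne_zero _))),
        (Nat.mul_le_mul_left n this).trans_lt h4'⟩
    · have := i.isLt
      omega
  constructor
  · rw [h.eigenDim_natCast hs, sum_univ_add_four, Nat.div_eq_of_lt_le h1 h1',
      Nat.div_eq_of_lt_le h2.le h2',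
      Nat.div_eq_of_lt_le h3.le h3', Nat.div_eq_of_lt_le h4.le h4', Finset.sum_eq_zero]
    · push_cast; ring
    · exact fun i _ => Nat.div_eq_of_lt_le (rest i).1.le (rest i).2
  · have hc : #{i | (n : ZMod m) * α i = 0} ≤ g := by
      rw [card_filter, sum_univ_add_four, if_neg (natCast_mul_ne_zero _ h2 h2'),
        if_neg (natCast_mul_ne_zero _ h3 h3'), if_neg (natCast_mul_ne_zero _ h4 h4'),
        Finset.sum_eq_zero fun i _ => if_neg (natCast_mul_ne_zero _ (rest i).1 (rest i).2)]
      rcases hg with rfl | hg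
      · split_ifs <;> simp
      · simp [natCast_mul_ne_zero _ hg h1']
    have := h.eigenDim_add_neg n
    omega

theorem noPair {α : Fin (r + 4) → ZMod m} (h : StarTuple α)
    (hs : ∑ i, (α i).val = m) (ha : Antitone fun i => (α i).val) :
    NoPair m (r + 4) (α 0).val (α 1).val (α 2).val (α 3).val := by
  rintro n n' hne hn hn' ⟨k₁, k₂, k₃, k₄, h1, h1', h2, h2', h3, h3', h4, h4', h0, h5⟩
    ⟨g, l₁, l₂, l₃, l₄, -, p1, p1', p1'', p2, p2', p3, p3', p4, p4', p0, p5, p6⟩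
  obtain ⟨f1, f2⟩ := h.eigenDim_bounds hs ha (g := 0) (by omega) (Or.inr h1) h1.le h1' h2 h2' h3
    h3' h4 h4' h0
  obtain ⟨f3, f4⟩ := h.eigenDim_bounds hs ha (by omega) p1 p1' p1'' p2 p2' p3
    p3' p4 p4' p0
  rw [f1] at f2
  rw [f3] at f4
  have e1 : eigenDim α n = 1 := by omega
  have e2 : 0 < eigenDim α n' * eigenDim α (-n') := mul_pos (by omega) (by omega)
  have e3 : eigenDim α n * eigenDim α (-n) + eigenDim α n' * eigenDim α (-n') ≤
      ((r + 4 : ℕ) : ℤ) - 3 := by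
    rcases lt_or_gt_of_ne hne with hlt | hlt
    · exact h.pair_le (by omega) hlt hn'
    · rw [add_comm]; exact h.pair_le (by omega) hlt hn
  rw [e1] at e3
  omega

theorem le_of_sum_val_eq (h : StarTuple α)
    (hs : ∑ i, (α i).val = m) (ha : Antitone fun i => (α i).val) : m ≤ 22 := by
  obtain ⟨r, rfl⟩ : ∃ r, N = r + 4 := ⟨N - 4, by have := h.four_le; omega⟩
  have no := h.noPair hs ha
  have hd : 0 < (α 3).val := Nat.pos_of_ne_zero ((ZMod.val_ne_zero _).2 (h.ne_zero _))
  have v1 : ((1 : Fin (r + 4)) : ℕ) = 1 := Nat.mod_eq_of_lt (show 1 < r + 4 by omega)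
  have v2 : ((2 : Fin (r + 4)) : ℕ) = 2 := Nat.mod_eq_of_lt (show 2 < r + 4 by omega)
  have v3 : ((3 : Fin (r + 4)) : ℕ) = 3 := Nat.mod_eq_of_lt (show 3 < r + 4 by omega)
  have hdc : (α 3).val ≤ (α 2).val :=
    ha (show (2 : Fin (r + 4)) ≤ 3 by rw [Fin.le_def]; omega)
  have hcb : (α 2).val ≤ (α 1).val :=
    ha (show (1 : Fin (r + 4)) ≤ 2 by rw [Fin.le_def]; omega)
  have hba : (α 1).val ≤ (α 0).val := ha (Fin.zero_le _)
  have split : (α 0).val + (α 1).val + (α 2).val + (α 3).val +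
      ∑ i : Fin r, (α i.succ.succ.succ.succ).val = m := by
    rw [sum_univ_add_four] at hs
    simpa only [add_assoc] using hs
  have hs4 : r + 4 = 4 → (α 0).val + (α 1).val + (α 2).val + (α 3).val = m := fun hr => by
    obtain rfl : r = 0 := by omega
    simpa using split
  rcases lt_or_ge (2 * (α 0).val) m with hlt | hge
  · exact no.le_of_two_mul_lt (by omega) hd hdc hcb hba (by omega) hs4 hlt
  · exact no.le_of_le_two_mul (by omega) hd hdc hcb hba (by omega) hs4 hge

end StarTuple

/-- The sum `∑ (n·a mod m)` for a list of weights. Explicit recursors and binary `Nat` functions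
keep kernel evaluation fast, here and in the next definitions. -/
def weightSum (m : ℕ) (l : List ℕ) (n : ℕ) : ℕ :=
  List.rec 0 (fun a _ s => Nat.add (Nat.mod (Nat.mul n a) m) s) l

theorem weightSum_eq (m : ℕ) (l : List ℕ) (n : ℕ) :
    weightSum m l n = (l.map fun a => n * a % m).sum := by
  induction l with
  | nil => rfl
  | cons a l ih => rw [List.map_cons, List.sum_cons, ← ih]; rfl

/-- The dimension `d_n` for a list of weights. -/
def charDim (m : ℕ) (l : List ℕ) (n : ℕ) : ℕ := Nat.sub (Nat.div (weightSum m l n) m) 1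

/-- The sum of `d_n·d_{m-n}` over the characters `1 ≤ n ≤ b`. -/
def starSum (m : ℕ) (l : List ℕ) (b : ℕ) : ℕ :=
  Nat.rec 0 (fun n s => Nat.add s
    (Nat.mul (charDim m l (Nat.succ n)) (charDim m l (Nat.sub m (Nat.succ n))))) b

theorem starSum_eq (m : ℕ) (l : List ℕ) (b : ℕ) :
    starSum m l b = ∑ n ∈ range b, charDim m l (n + 1) * charDim m l (m - (n + 1)) := by
  induction b with
  | zero => rfl
  | succ b ih => rw [sum_range_succ, ← ih]; rfl

/-- For a list of weights: if (⋆) holds and the weights are not too degenerate, then the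
numerical bounds hold. -/
def boundsTest (m : ℕ) (l : List ℕ) : Bool :=
  Nat.blt l.length 4 ||
  Nat.blt l.length (starSum m l (min 4 ((m - 1) / 2)) + 3) ||
  !(Nat.beq (2 * starSum m l ((m - 1) / 2) +
    (if m % 2 = 0 then charDim m l (m / 2) * (charDim m l (m / 2) + 1) else 0) + 6)
    (2 * l.length)) ||
  (List.range (m - 1)).any (fun n => Nat.beq (weightSum m l (n + 1)) 0) ||
  (Nat.ble l.length 6 && Nat.ble m 12 &&
    Nat.ble ((List.range (m - 1)).map fun n => charDim m l (n + 1)).sum 7)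

/-- Check a predicate on every decreasing list extending `acc.reverse` by positive
entries at most `top` with sum `left`. -/
def forallPartitions (P : List ℕ → Bool) (fuel : ℕ) : (left top : ℕ) → (acc : List ℕ) → Bool :=
  Nat.rec (fun _ _ _ => false)
    (fun _ ih left top acc =>
      Nat.rec (P acc.reverse)
        (fun s _ => Nat.rec true
          (fun t _ => ih (s + 1) t acc &&
            (Nat.blt s t || ih (s - t) (t + 1) ((t + 1) :: acc))) top) left) fuel

theorem forallPartitions_succ (P : List ℕ → Bool) (fuel s t : ℕ) (acc : List ℕ) :
    forallPartitions P (fuel + 1) (s + 1) (t + 1) acc =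
      (forallPartitions P fuel (s + 1) t acc &&
        (Nat.blt s t || forallPartitions P fuel (s - t) (t + 1) ((t + 1) :: acc))) := rfl

theorem forallPartitions_sound {P : List ℕ → Bool} {fuel left top : ℕ} {acc l : List ℕ}
    (h : forallPartitions P fuel left top acc = true) (hl : l.Pairwise (· ≥ ·))
    (hl' : ∀ x ∈ l, 1 ≤ x ∧ x ≤ top) (hs : l.sum = left) : P (acc.reverse ++ l) = true := by
  induction fuel generalizing left top acc l with
  | zero => simp [forallPartitions] at h
  | succ fuel ih =>
    cases l with
    | nil =>
      obtain rfl : left = 0 := by simpa using hs.symm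
      simpa [forallPartitions] using h
    | cons x t =>
      have hx := hl' x List.mem_cons_self
      rw [List.sum_cons] at hs
      obtain ⟨left, rfl⟩ : ∃ s, left = s + 1 := ⟨left - 1, by omega⟩
      obtain ⟨top, rfl⟩ : ∃ s, top = s + 1 := ⟨top - 1, by omega⟩
      rw [forallPartitions_succ, Bool.and_eq_true] at h
      rw [List.pairwise_cons] at hl
      rcases hx.2.eq_or_lt with rfl | hlt
      · have hb : Nat.blt left top = false := by
          rw [← Bool.not_eq_true, Nat.blt_eq]; omega
        rw [hb, Bool.false_or] at h
        have := ih h.2 hl.2 (fun y hy => hl' y (List.mem_cons_of_mem _ hy)) (by omega)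
        simpa using this
      · refine ih h.1 (List.pairwise_cons.2 hl) (fun y hy => ⟨(hl' y hy).1, ?_⟩)
          (by rw [List.sum_cons]; omega)
        rcases List.mem_cons.1 hy with rfl | hy
        · omega
        · have := hl.1 y hy
          omega

theorem forallPartitions_boundsTest : ∀ m < 23,
    forallPartitions (boundsTest m) (2 * m + 1) m (m - 1) [] = true := by
  decide +kernel

theorem forallPartitions_boundsTest_small :
    ∀ p ∈ [(2, 4), (2, 6), (3, 6), (4, 8), (6, 12)],
      forallPartitions (boundsTest p.1) (2 * p.2) p.2 (p.1 - 1) [] = true := by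
  decide +kernel

namespace StarTuple

variable {m N : ℕ} [NeZero m] {α : Fin N → ZMod m}

omit [NeZero m] in
theorem weightSum_ofFn (n : ℕ) :
    weightSum m (List.ofFn fun i => (α i).val) n = ∑ i, ((n : ZMod m) * α i).val := by
  rw [weightSum_eq, List.map_ofFn, List.sum_ofFn]
  refine sum_congr rfl fun i _ => ?_
  rw [ZMod.val_mul, ZMod.val_natCast, Nat.mod_mul_mod]
  rfl

theorem charDim_ofFn (h : StarTuple α) {n : ℕ} (h0 : 0 < n) (hn : n < m) :
    (charDim m (List.ofFn fun i => (α i).val) n : ℤ) = eigenDim α n := by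
  have h1 := h.eigenDim_nonneg (natCast_ne_zero h0 hn)
  rw [show charDim m _ n = weightSum m _ n / m - 1 from rfl, weightSum_ofFn]
  rw [eigenDim] at h1 ⊢
  rw [← Nat.cast_sum, ← Int.natCast_div] at h1 ⊢
  omega

theorem sum_range_eq (f : ZMod m → ℤ) :
    ∑ x ∈ univ.erase (0 : ZMod m), f x = ∑ n ∈ range (m - 1), f ((n + 1 : ℕ) : ZMod m) := by
  have := NeZero.pos m
  rw [sum_erase_zero, show Icc 1 (m - 1) = Ico 1 m by ext; simp only [mem_Icc, mem_Ico]; omega,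
    sum_Ico_eq_sum_range]
  simp only [add_comm]

theorem bounds_of_boundsTest (h : StarTuple α)
    (ht : boundsTest m (List.ofFn fun i => (α i).val) = true) :
    N ≤ 6 ∧ m ≤ 12 ∧ totalDim α ≤ 7 := by
  set l := List.ofFn fun i => (α i).val with hl
  have hlen : l.length = N := List.length_ofFn
  have hm := NeZero.pos m
  have h4 := h.four_le
  have dim : ∀ n : ℕ, n ∈ range (m - 1) → (charDim m l (n + 1) : ℤ) = eigenDim α (n + 1 : ℕ) :=
    fun n hn => h.charDim_ofFn (by omega) (by have := mem_range.1 hn; omega)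
  have star : 2 * starSum m l ((m - 1) / 2) +
      (if m % 2 = 0 then charDim m l (m / 2) * (charDim m l (m / 2) + 1) else 0) + 6 =
      2 * N := by
    have e := h.star
    rw [symmetrised_sum_eq, show Icc 1 ((m - 1) / 2) = Ico 1 ((m - 1) / 2 + 1) from rfl,
      sum_Ico_eq_sum_range, Nat.add_sub_cancel] at e
    have e1 : (starSum m l ((m - 1) / 2) : ℤ) = ∑ n ∈ range ((m - 1) / 2),
        eigenDim α (1 + n : ℕ) * eigenDim α (-(1 + n : ℕ)) := by
      rw [starSum_eq, Nat.cast_sum]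
      refine sum_congr rfl fun n hn => ?_
      have := mem_range.1 hn
      rw [Nat.cast_mul, h.charDim_ofFn (by omega) (by omega),
        h.charDim_ofFn (by omega) (by omega), Nat.cast_sub (by omega), add_comm 1 n]
      simp
    have e2 : (if m % 2 = 0 then
          eigenDim α (m / 2 : ℕ) * (eigenDim α (m / 2 : ℕ) + 1) else 0) =
        ((if m % 2 = 0 then charDim m l (m / 2) * (charDim m l (m / 2) + 1) else 0 : ℕ) : ℤ) := by
      split_ifs with h2
      · push_cast
        rw [h.charDim_ofFn (by omega) (by omega)]
      · rfl
    rw [e2, ← e1] at e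
    omega
  have early : starSum m l (min 4 ((m - 1) / 2)) ≤ starSum m l ((m - 1) / 2) := by
    rw [starSum_eq, starSum_eq]
    exact Finset.sum_le_sum_of_subset (range_subset_range.2 (min_le_right _ _))
  have total : totalDim α = (((List.range (m - 1)).map fun n => charDim m l (n + 1)).sum : ℕ) := by
    rw [totalDim, sum_range_eq, sum_congr rfl fun n hn => (dim n hn).symm, ← Nat.cast_sum]
    rfl
  have faithful : ∀ n ∈ range (m - 1), weightSum m l (n + 1) ≠ 0 := fun n hn h0 => by
    have e := mem_range.1 hn
    obtain ⟨i, hi⟩ := h.faithful _ (natCast_ne_zero (m := m) (n := n + 1) (by omega) (by omega))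
    rw [weightSum_ofFn, Finset.sum_eq_zero_iff] at h0
    exact hi ((ZMod.val_eq_zero _).1 (h0 i (mem_univ i)))
  simp only [boundsTest, Bool.or_eq_true, Bool.and_eq_true, Nat.blt_eq, Nat.ble_eq,
    Bool.not_eq_true', ← Bool.not_eq_true, Nat.beq_eq, List.any_eq_true, hlen] at ht
  rcases ht with (((ht | ht) | ht) | ⟨n, hn, ht⟩) | ⟨⟨h1, h2⟩, h3⟩
  · omega
  · omega
  · exact absurd star ht
  · exact absurd ht (faithful n (by simpa using hn))
  · exact ⟨h1, h2, by rw [total]; exact_mod_cast h3⟩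

theorem boundsTest_of_forallPartitions (h : StarTuple α) (ha : Antitone fun i => (α i).val)
    {fuel : ℕ}
    (ht : forallPartitions (boundsTest m) fuel (∑ i, (α i).val) (m - 1) [] = true) :
    boundsTest m (List.ofFn fun i => (α i).val) = true := by
  refine forallPartitions_sound (l := List.ofFn fun i => (α i).val) ht ?_ ?_ List.sum_ofFn
  · rw [List.pairwise_ofFn]
    exact fun i j hij => ha hij.le
  · intro x hx
    obtain ⟨i, rfl⟩ := (List.mem_ofFn' _ _).1 hx
    have := (ZMod.val_ne_zero _).2 (h.ne_zero i)
    have := (α i).val_lt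
    dsimp only
    omega

theorem bounds (h : StarTuple α) (h2 : 2 ≤ m) : N ≤ 6 ∧ m ≤ 12 ∧ totalDim α ≤ 7 := by
  obtain ⟨u, hu⟩ := h.exists_unit_sum_val h2
  obtain ⟨σ, hσ⟩ := exists_antitone_perm fun i => ((u : ZMod m) * α i).val
  have hβ := (h.unit_mul u).comp_perm σ
  set β : Fin N → ZMod m := (fun i => (u : ZMod m) * α i) ∘ σ
  have hs : ∑ i, (β i).val = ∑ i, ((u : ZMod m) * α i).val :=
    Equiv.sum_comp σ fun i => ((u : ZMod m) * α i).val
  have ht : totalDim β = totalDim α :=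
    (sum_congr rfl fun x _ => eigenDim_comp_perm σ x).trans (totalDim_unit_mul u)
  have ha : Antitone fun i => (β i).val := hσ
  rw [← hs] at hu
  rw [← ht]
  refine hβ.bounds_of_boundsTest ?_
  rcases hu with hu | hu
  · have hm := hβ.le_of_sum_val_eq hu ha
    have := forallPartitions_boundsTest m (by omega)
    exact hβ.boundsTest_of_forallPartitions ha (by rw [hu]; exact this)
  · have := forallPartitions_boundsTest_small _ hu
    dsimp only at this
    exact hβ.boundsTest_of_forallPartitions ha this

end StarTuple

/-- If `(m, N, a)` satisfies condition (⋆), then `N ≤ 6`, `m ≤ 12`, and the genus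
`g = ∑_{n=1}^{m−1} d_n` satisfies `g ≤ 7`. -/
theorem star_bounds (m N : ℕ) (a : Fin N → ℤ)
    (htriple : IsTriple m N a) (hstar : CondStar m N a) :
    N ≤ 6 ∧ m ≤ 12 ∧ ∑ n ∈ Finset.Icc 1 (m - 1), hodgeDim m N a n ≤ 7 := by
  have hm : 2 ≤ m := htriple.1
  have : NeZero m := ⟨by omega⟩
  obtain ⟨h1, h2, h3⟩ := (StarTuple.of_condStar htriple hstar).bounds hm
  refine ⟨h1, h2, ?_⟩
  rw [StarTuple.sum_hodgeDim_eq htriple.2.2.2.2]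
  exact_mod_cast h3
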